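/- arXiv:1501.07577 — 2 statements merged into one kernel-verified Lean document; each statement's English description precedes it below -/
import Mathlib

section
/- Let C ≥ 1 and let P(z) = Σ_{j=1}^m C_j z^j (m ≥ 1) be a polynomial with strictly positive coefficients C_j and no constant term, and set Q(z) = Σ_{j=1}^m C_j z^{j-1}, so that P(z) = z·Q(z). Let T* > 0 and let X, Z : [0,T*] → [0,∞) be continuous functions such that Z is nondecreasing, Z(0) > 0, X(0) ≤ C·Z(0), and X(T) ≤ C·Z(T) + √T · P(X(T)) for every T ∈ [0,T*]. Define T₄ ≥ 0 by √T₄ = 1/(2·Q(2C·Z(T*))). Then X(T) ≤ 2C·Z(T) for every T ∈ [0, min(T₄, T*)]. -/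
open Set

/-- The abstract bootstrap/continuity argument from the proof of the κ-independent a
priori estimates: if `X(T) ≤ C·Z(T) + √T·P(X(T))` with `P` a positive-coefficient
polynomial without constant term, `P(z) = z·Q(z)`, and `X(0) ≤ C·Z(0)`, then
`X(T) ≤ 2C·Z(T)` for `T ≤ min(T₄, T*)` where `√T₄ = 1/(2·Q(2C·Z(T*)))`. -/
theorem stmt_0
    (C : ℝ) (hC : 1 ≤ C)
    (m : ℕ) (hm : 1 ≤ m)
    (coeff : ℕ → ℝ) (hcoeff : ∀ j ∈ Finset.Icc 1 m, 0 < coeff j)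
    (P Q : ℝ → ℝ)
    (hP : ∀ z, P z = ∑ j ∈ Finset.Icc 1 m, coeff j * z ^ j)
    (hQ : ∀ z, Q z = ∑ j ∈ Finset.Icc 1 m, coeff j * z ^ (j - 1))
    (Tstar : ℝ) (hTstar : 0 < Tstar)
    (X Z : ℝ → ℝ)
    (hXcont : ContinuousOn X (Icc 0 Tstar))
    (hZcont : ContinuousOn Z (Icc 0 Tstar))
    (hXnonneg : ∀ t ∈ Icc 0 Tstar, 0 ≤ X t)
    (hZnonneg : ∀ t ∈ Icc 0 Tstar, 0 ≤ Z t)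
    (hZmono : MonotoneOn Z (Icc 0 Tstar))
    (hZ0 : 0 < Z 0)
    (hX0 : X 0 ≤ C * Z 0)
    (hboot : ∀ T ∈ Icc 0 Tstar, X T ≤ C * Z T + Real.sqrt T * P (X T))
    (T₄ : ℝ) (hT₄nonneg : 0 ≤ T₄)
    (hT₄ : Real.sqrt T₄ = 1 / (2 * Q (2 * C * Z Tstar))) :
    ∀ T ∈ Icc 0 (min T₄ Tstar), X T ≤ 2 * C * Z T := by
  rintro T ⟨hT0, hTmin⟩
  have hTT₄ : T ≤ T₄ := hTmin.trans (min_le_left _ _)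
  have hTT : T ≤ Tstar := hTmin.trans (min_le_right _ _)
  have hPQ : ∀ z, P z = z * Q z := by
    intro z
    rw [hP, hQ, Finset.mul_sum]
    refine Finset.sum_congr rfl fun j hj => ?_
    rw [← mul_pow_sub_one (by have := (Finset.mem_Icc.1 hj).1; lia) z]
    ring
  have hQmono : ∀ x y, 0 ≤ x → x ≤ y → Q x ≤ Q y := by
    intro x y hx hxy
    rw [hQ, hQ]
    exact Finset.sum_le_sum fun j hj =>
      mul_le_mul_of_nonneg_left (pow_le_pow_left₀ hx hxy _) (hcoeff j hj).le
  have hQpos : ∀ x, 0 < x → 0 < Q x := by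
    intro x hx
    rw [hQ]
    exact Finset.sum_pos (fun j hj => mul_pos (hcoeff j hj) (pow_pos hx _))
      ⟨1, Finset.mem_Icc.2 ⟨le_rfl, hm⟩⟩
  have hZpos : ∀ t ∈ Icc 0 Tstar, 0 < Z t := fun t ht =>
    hZ0.trans_le (hZmono ⟨le_rfl, hTstar.le⟩ ht ht.1)
  have hC0 : 0 < C := by linarith
  by_contra! hlt
  have hsub : Icc 0 T ⊆ Icc 0 Tstar := Icc_subset_Icc_right hTT
  have hcont : ContinuousOn (fun t => X t - 2 * C * Z t) (Icc 0 T) :=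
    (hXcont.mono hsub).sub (continuousOn_const.mul (hZcont.mono hsub))
  obtain ⟨s, ⟨hs0, hsT⟩, hs⟩ := intermediate_value_Ioo hT0 hcont
    (show (0 : ℝ) ∈ Ioo _ _ from
      ⟨by have := mul_pos hC0 hZ0; linarith, by linarith⟩)
  have hsmem : s ∈ Icc 0 Tstar := ⟨hs0.le, hsT.le.trans hTT⟩
  have hXs : X s = 2 * (C * Z s) := by
    have : X s - 2 * C * Z s = 0 := hs
    linarith
  have hCZ : 0 < C * Z s := mul_pos hC0 (hZpos s hsmem)
  have hCZle : C * Z s ≤ C * Z Tstar :=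
    mul_le_mul_of_nonneg_left (hZmono hsmem ⟨hTstar.le, le_rfl⟩ hsmem.2) hC0.le
  have hQle : Q (X s) ≤ Q (2 * C * Z Tstar) := hQmono _ _ (by linarith) (by linarith)
  have hQstar : 0 < Q (2 * C * Z Tstar) := hQpos _ (by linarith)
  have hsqrt : √s < 1 / (2 * Q (2 * C * Z Tstar)) :=
    hT₄ ▸ Real.sqrt_lt_sqrt hs0.le (hsT.trans_le hTT₄)
  rw [lt_div_iff₀ (by positivity)] at hsqrt
  have hsmall : √s * Q (X s) < 1 / 2 := by
    have := mul_le_mul_of_nonneg_left hQle (Real.sqrt_nonneg s)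
    linarith
  have hbs := hboot s hsmem
  rw [hPQ] at hbs
  have hprod : √s * (X s * Q (X s)) < C * Z s := by
    calc √s * (X s * Q (X s)) = X s * (√s * Q (X s)) := by ring
      _ < X s * (1 / 2) := mul_lt_mul_of_pos_left hsmall (by linarith)
      _ = C * Z s := by rw [hXs]; ring
  linarith
end

section
/- Fix L₁, L₂ > 0, a < b, T > 0, and say a function is horizontally periodic if it is (2πL₁)-periodic in x₁ and (2πL₂)-periodic in x₂; let Q = [0,2πL₁] × [0,2πL₂] × [a,b]. Let v : ℝ² × [a,b] × [0,T] → ℝ³ be continuously differentiable, horizontally periodic, bounded with bounded derivatives, and with v₃ = 0 on {x₃ = a} and {x₃ = b}; let c : ℝ² × [a,b] × [0,T] → ℝ be continuously differentiable, horizontally periodic, and bounded. Suppose q : ℝ² × [a,b] × (0,T) → ℝ is measurable, horizontally periodic, satisfies ∫₀^T ∫_Q |q(x,t)|² dx dt < ∞, and satisfies ∫₀^T ∫_Q q(x,t)·( ∂_tφ + ∇·(vφ) − cφ )(x,t) dx dt = 0 for every continuously differentiable, horizontally periodic test function φ that vanishes whenever x₃ lies outside some compact subset of (a,b) or t ≥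 T′ for some T′ < T. Then q = 0 almost everywhere on Q × (0,T). -/
open Set MeasureTheory

/-- The periodic cell `Q = [0,2πL₁] × [0,2πL₂] × [a,b]` of the horizontally
periodic slab. -/
def slabQ (L₁ L₂ a b : ℝ) : Set (Fin 3 → ℝ) :=
  {x | x 0 ∈ Set.Icc 0 (2 * Real.pi * L₁) ∧ x 1 ∈ Set.Icc 0 (2 * Real.pi * L₂) ∧
       x 2 ∈ Set.Icc a b}

/-- A function on `ℝ³` is horizontally periodic if it is `(2πL₁)`-periodic in
`x₁` and `(2πL₂)`-periodic in `x₂`. -/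
def HorPeriodic (L₁ L₂ : ℝ) {α : Type*} (h : (Fin 3 → ℝ) → α) : Prop :=
  ∀ x : Fin 3 → ℝ,
    h (x + (2 * Real.pi * L₁) • (Pi.single 0 1 : Fin 3 → ℝ)) = h x ∧
    h (x + (2 * Real.pi * L₂) • (Pi.single 1 1 : Fin 3 → ℝ)) = h x

/-- Test functions for the weak formulation of the transport problem on the
horizontally periodic slab: continuously differentiable, horizontally periodic,
vanishing whenever `x₃` lies outside some compact subset of `(a,b)` or
`t ≥ T'` for some `T' < T`. -/
def IsTestFn (L₁ L₂ a b T : ℝ) (φ : (Fin 3 → ℝ) → ℝ → ℝ) : Prop :=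
  ContDiff ℝ 1 (fun p : (Fin 3 → ℝ) × ℝ => φ p.1 p.2) ∧
  (∀ t : ℝ, HorPeriodic L₁ L₂ fun x => φ x t) ∧
  (∃ K : Set ℝ, IsCompact K ∧ K ⊆ Set.Ioo a b ∧
    ∀ (x : Fin 3 → ℝ) (t : ℝ), x 2 ∉ K → φ x t = 0) ∧
  (∃ T' : ℝ, T' < T ∧ ∀ (x : Fin 3 → ℝ) (t : ℝ), T' ≤ t → φ x t = 0)


section Euler

variable {E G : Type*} [NormedAddCommGroup E] [NormedSpace ℝ E] [ProperSpace E]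
  [NormedAddCommGroup G] [NormedSpace ℝ G]

/-- A `C¹` map is, uniformly on balls, first-order approximated by its derivative. -/
lemma exists_norm_taylor_one_le {f : E → G} (hf : ContDiff ℝ 1 f) (R : ℝ) {η : ℝ} (hη : 0 < η) :
    ∃ δ > 0, ∀ p : E, ‖p‖ ≤ R → ∀ u : E, ‖u‖ ≤ δ →
      ‖f (p + u) - f p - fderiv ℝ f p u‖ ≤ η * ‖u‖ := by
  have hcont : UniformContinuousOn (fderiv ℝ f) (Metric.closedBall (0 : E) (R + 1)) :=
    (isCompact_closedBall _ _).uniformContinuousOn_of_continuous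
      (hf.continuous_fderiv one_ne_zero).continuousOn
  obtain ⟨δ, hδ, H⟩ := Metric.uniformContinuousOn_iff.1 hcont η hη
  refine ⟨min (δ / 2) 1, by positivity, fun p hp u hu => ?_⟩
  have hu1 : ‖u‖ ≤ δ / 2 := hu.trans (min_le_left _ _)
  have hu2 : ‖u‖ ≤ 1 := hu.trans (min_le_right _ _)
  have key := (convex_closedBall p ‖u‖).norm_image_sub_le_of_norm_hasFDerivWithin_le'
    (f := f) (f' := fderiv ℝ f) (φ := fderiv ℝ f p) (C := η) (x := p) (y := p + u)
    (fun z _ => (hf.differentiable one_ne_zero z).hasFDerivAt.hasFDerivWithinAt)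
    (fun z hz => by
      rw [mem_closedBall_iff_norm] at hz
      rw [← dist_eq_norm]
      refine (H z ?_ p ?_ ?_).le
      · rw [mem_closedBall_zero_iff]
        have := norm_add_le (z - p) p
        rw [sub_add_cancel] at this
        linarith
      · rw [mem_closedBall_zero_iff]; linarith
      · rw [dist_eq_norm]; linarith)
    (by simp) (by simp)
  simpa using key

/-- One step of length `h` of the explicit Euler scheme for the vector field `V`. -/
def eulerStep (V : E → E) (h : ℝ) (p : E) : E := p + h • V p

/-- The discrete potential obtained by summing `F` along `N` Euler steps of length `h`. It
approximately solves `Dφ · V = F`. -/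
def eulerPotential (V : E → E) (F : E → ℝ) (h : ℝ) (N : ℕ) (p : E) : ℝ :=
  -(h * ∑ k ∈ Finset.range N, F ((eulerStep V h)^[k] p))

omit [ProperSpace E] in
lemma contDiff_eulerStep {V : E → E} (hV : ContDiff ℝ 1 V) (h : ℝ) :
    ContDiff ℝ 1 (eulerStep V h) :=
  contDiff_id.add (contDiff_const.smul hV)

omit [ProperSpace E] in
lemma contDiff_eulerStep_iterate {V : E → E} (hV : ContDiff ℝ 1 V) (h : ℝ) (k : ℕ) :
    ContDiff ℝ 1 ((eulerStep V h)^[k]) := by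
  induction k with
  | zero => exact contDiff_id
  | succ k ih => exact ih.comp (contDiff_eulerStep hV h)

omit [ProperSpace E] in
lemma contDiff_eulerPotential {V : E → E} {F : E → ℝ} (hV : ContDiff ℝ 1 V)
    (hF : ContDiff ℝ 1 F) (h : ℝ) (N : ℕ) : ContDiff ℝ 1 (eulerPotential V F h N) :=
  (contDiff_const.mul (ContDiff.sum fun k _ =>
    hF.comp (contDiff_eulerStep_iterate hV h k))).neg

omit [ProperSpace E] in
lemma norm_eulerStep_iterate_le {V : E → E} {M h : ℝ} (hVM : ∀ p, ‖V p‖ ≤ M) (hh : 0 ≤ h)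
    (p : E) (k : ℕ) : ‖(eulerStep V h)^[k] p‖ ≤ ‖p‖ + k * h * M := by
  induction k with
  | zero => simp
  | succ k ih =>
    rw [Function.iterate_succ_apply', eulerStep]
    have h1 := norm_add_le ((eulerStep V h)^[k] p) (h • V ((eulerStep V h)^[k] p))
    have h2 : ‖h • V ((eulerStep V h)^[k] p)‖ ≤ h * M := by
      rw [norm_smul, Real.norm_of_nonneg hh]
      exact mul_le_mul_of_nonneg_left (hVM _) hh
    push_cast
    linarith

omit [ProperSpace E] in
/-- The vector field is almost invariant under the derivative of the Euler iterates. -/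
lemma norm_fderiv_eulerStep_iterate_sub_le {V : E → E} (hV : ContDiff ℝ 1 V) {M h η : ℝ}
    (hM : 0 ≤ M) (hh : 0 ≤ h) (hη : 0 ≤ η)
    (hDV : ∀ p, ‖fderiv ℝ V p‖ ≤ M) (p : E) (N : ℕ)
    (H : ∀ k < N, ‖V ((eulerStep V h)^[k] p + h • V ((eulerStep V h)^[k] p))
        - V ((eulerStep V h)^[k] p)
        - fderiv ℝ V ((eulerStep V h)^[k] p) (h • V ((eulerStep V h)^[k] p))‖ ≤ η * (h * M))
    (k : ℕ) (hk : k ≤ N) :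
    ‖fderiv ℝ ((eulerStep V h)^[k]) p (V p) - V ((eulerStep V h)^[k] p)‖
      ≤ k * (η * (h * M)) * (1 + h * M) ^ k := by
  induction k with
  | zero => simp
  | succ k ih =>
    specialize ih (by omega)
    have Hk := H k (by omega)
    set z := (eulerStep V h)^[k] p with hz
    have hd : Differentiable ℝ (eulerStep V h) := (contDiff_eulerStep hV h).differentiable one_ne_zero
    have hstep : HasFDerivAt (eulerStep V h) (ContinuousLinearMap.id ℝ E + h • fderiv ℝ V z) z :=
      (hasFDerivAt_id z).add ((hV.differentiable one_ne_zero z).hasFDerivAt.const_smul h)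
    have hcomp : fderiv ℝ ((eulerStep V h)^[k + 1]) p
        = (ContinuousLinearMap.id ℝ E + h • fderiv ℝ V z).comp
          (fderiv ℝ ((eulerStep V h)^[k]) p) := by
      rw [Function.iterate_succ']
      exact (hstep.comp p (hd.iterate k p).hasFDerivAt).fderiv
    rw [hcomp, Function.iterate_succ_apply', ← hz, eulerStep]
    set w := fderiv ℝ ((eulerStep V h)^[k]) p (V p) with hw
    have e : ((ContinuousLinearMap.id ℝ E + h • fderiv ℝ V z).comp
          (fderiv ℝ ((eulerStep V h)^[k]) p)) (V p) - V (z + h • V z)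
        = (w - V z) + h • fderiv ℝ V z (w - V z)
          - (V (z + h • V z) - V z - fderiv ℝ V z (h • V z)) := by
      simp [← hw, smul_sub]
      abel
    rw [e]
    have h1 : ‖h • fderiv ℝ V z (w - V z)‖ ≤ h * (M * ‖w - V z‖) := by
      rw [norm_smul, Real.norm_of_nonneg hh]
      exact mul_le_mul_of_nonneg_left ((fderiv ℝ V z).le_of_opNorm_le (hDV z) _) hh
    have h2 : ‖(w - V z) + h • fderiv ℝ V z (w - V z)
          - (V (z + h • V z) - V z - fderiv ℝ V z (h • V z))‖
        ≤ (1 + h * M) * ‖w - V z‖ + η * (h * M) := by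
      refine (norm_sub_le _ _).trans ?_
      have := norm_add_le (w - V z) (h • fderiv ℝ V z (w - V z))
      linarith
    refine h2.trans ?_
    have hhM : 0 ≤ h * M := by positivity
    have h3 : (1 + h * M) * ‖w - V z‖
        ≤ (1 + h * M) * (k * (η * (h * M)) * (1 + h * M) ^ k) :=
      mul_le_mul_of_nonneg_left ih (by positivity)
    have h4 : η * (h * M) * 1 ≤ η * (h * M) * (1 + h * M) ^ (k + 1) :=
      mul_le_mul_of_nonneg_left (one_le_pow₀ (by linarith)) (by positivity)
    push_cast
    calc _ ≤ (1 + h * M) * (k * (η * (h * M)) * (1 + h * M) ^ k)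
          + η * (h * M) * (1 + h * M) ^ (k + 1) := by linarith
      _ = _ := by ring

/-- The discrete potential approximately solves `Dφ · V = F` on bounded sets, at points whose
Euler orbit leaves the support of `F` by time `T`. -/
lemma eventually_abs_fderiv_eulerPotential_sub_le {V : E → E} {F : E → ℝ}
    (hV : ContDiff ℝ 1 V) (hF : ContDiff ℝ 1 F) {M : ℝ} (hM : 0 < M) (hVM : ∀ p, ‖V p‖ ≤ M)
    (hDV : ∀ p, ‖fderiv ℝ V p‖ ≤ M) (R : ℝ) {T : ℝ} (hT : 0 < T) {ε : ℝ} (hε : 0 < ε) :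
    ∀ᶠ N : ℕ in Filter.atTop, ∀ p : E, ‖p‖ ≤ R →
      F ((eulerStep V (T / N))^[N] p) = 0 →
      |fderiv ℝ (eulerPotential V F (T / N) N) p (V p) - F p| ≤ ε := by
  obtain ⟨L₀, hL₀⟩ := (isCompact_closedBall (0 : E) (R + T * M)).exists_bound_of_continuousOn
    (hF.continuous_fderiv one_ne_zero).continuousOn
  set L := max L₀ 0
  have hL : ∀ p : E, ‖p‖ ≤ R + T * M → ‖fderiv ℝ F p‖ ≤ L := fun p hp =>
    (hL₀ p (by simpa using hp)).trans (le_max_left _ _)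
  have hL0 : 0 ≤ L := le_max_right _ _
  set C := T * (L * (T * M * Real.exp (T * M)) + M) with hC
  have hC0 : 0 < C := by positivity
  set η := ε / C with hη
  have hη0 : 0 < η := by positivity
  obtain ⟨δ₁, hδ₁, H₁⟩ := exists_norm_taylor_one_le hV (R + T * M) hη0
  obtain ⟨δ₂, hδ₂, H₂⟩ := exists_norm_taylor_one_le hF (R + T * M) hη0
  have hlim : Filter.Tendsto (fun N : ℕ => T / (N : ℝ) * M) Filter.atTop (nhds 0) := by
    simpa using (tendsto_const_div_atTop_nhds_zero_nat T).mul_const M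
  filter_upwards [hlim.eventually_le_const hδ₁, hlim.eventually_le_const hδ₂,
    Filter.eventually_gt_atTop 0] with N hN₁ hN₂ hN p hp hFp
  have hNr : (0 : ℝ) < N := by exact_mod_cast hN
  set h := T / (N : ℝ) with hh
  have hh0 : 0 < h := by positivity
  have hNh : N * h = T := by rw [hh]; field_simp
  have hkh : ∀ k ≤ N, (k : ℝ) * h ≤ T := fun k hk => by
    rw [← hNh]; gcongr
  have hball : ∀ k ≤ N, ‖(eulerStep V h)^[k] p‖ ≤ R + T * M := fun k hk => by
    refine (norm_eulerStep_iterate_le hVM hh0.le p k).trans ?_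
    have := mul_le_mul_of_nonneg_right (hkh k hk) hM.le
    linarith
  have hsm : ∀ z, ‖h • V z‖ ≤ h * M := fun z => by
    rw [norm_smul, Real.norm_of_nonneg hh0.le]
    exact mul_le_mul_of_nonneg_left (hVM _) hh0.le
  have herr := norm_fderiv_eulerStep_iterate_sub_le hV hM.le hh0.le hη0.le hDV p N
    (fun k hk => (H₁ _ (hball k hk.le) _ ((hsm _).trans hN₁)).trans
      (mul_le_mul_of_nonneg_left (hsm _) hη0.le))
  have herr' : ∀ k ≤ N, ‖fderiv ℝ ((eulerStep V h)^[k]) p (V p) - V ((eulerStep V h)^[k] p)‖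
      ≤ η * (T * M * Real.exp (T * M)) := fun k hk => by
    refine (herr k hk).trans ?_
    have h1 : (1 + h * M) ^ k ≤ Real.exp (T * M) := by
      calc (1 + h * M) ^ k ≤ Real.exp (h * M) ^ k := by
            gcongr
            linarith [Real.add_one_le_exp (h * M)]
        _ = Real.exp (k * h * M) := by rw [← Real.exp_nat_mul]; ring_nf
        _ ≤ _ := Real.exp_le_exp.2 (mul_le_mul_of_nonneg_right (hkh k hk) hM.le)
    calc (k : ℝ) * (η * (h * M)) * (1 + h * M) ^ k
        = η * ((k * h) * M * (1 + h * M) ^ k) := by ring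
      _ ≤ _ := by
        have := hkh k hk
        gcongr
  have hderiv : fderiv ℝ (eulerPotential V F h N) p (V p) = -(h * ∑ k ∈ Finset.range N,
      fderiv ℝ F ((eulerStep V h)^[k] p) (fderiv ℝ ((eulerStep V h)^[k]) p (V p))) := by
    have hs : HasFDerivAt (eulerPotential V F h N) (-(h • ∑ k ∈ Finset.range N,
        (fderiv ℝ F ((eulerStep V h)^[k] p)).comp (fderiv ℝ ((eulerStep V h)^[k]) p))) p := by
      refine HasFDerivAt.neg (HasFDerivAt.const_mul (HasFDerivAt.fun_sum fun k _ => ?_) h)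
      exact (hF.differentiable one_ne_zero _).hasFDerivAt.comp p
        ((contDiff_eulerStep_iterate hV h k).differentiable one_ne_zero p).hasFDerivAt
    rw [hs.fderiv]
    simp
  have htel : F p = -∑ k ∈ Finset.range N,
      (F ((eulerStep V h)^[k + 1] p) - F ((eulerStep V h)^[k] p)) := by
    rw [Finset.sum_range_sub (fun k => F ((eulerStep V h)^[k] p)), hFp]
    simp
  have hterm : ∀ k ∈ Finset.range N,
      |(F ((eulerStep V h)^[k + 1] p) - F ((eulerStep V h)^[k] p))
        - h * fderiv ℝ F ((eulerStep V h)^[k] p) (fderiv ℝ ((eulerStep V h)^[k]) p (V p))|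
      ≤ h * (η * (L * (T * M * Real.exp (T * M)) + M)) := by
    intro k hk
    have hk' := (Finset.mem_range.1 hk).le
    rw [Function.iterate_succ_apply']
    have hb := hball k hk'
    have he := herr' k hk'
    set z := (eulerStep V h)^[k] p
    set w := fderiv ℝ ((eulerStep V h)^[k]) p (V p)
    have h2 := (H₂ z hb _ ((hsm z).trans hN₂)).trans (mul_le_mul_of_nonneg_left (hsm z) hη0.le)
    have h3 : |fderiv ℝ F z (w - V z)| ≤ L * (η * (T * M * Real.exp (T * M))) :=
      ((fderiv ℝ F z).le_of_opNorm_le (hL z hb) _).trans (mul_le_mul_of_nonneg_left he hL0)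
    have e : F (eulerStep V h z) - F z - h * fderiv ℝ F z w
        = (F (z + h • V z) - F z - fderiv ℝ F z (h • V z)) - h * fderiv ℝ F z (w - V z) := by
      simp [eulerStep]; ring
    rw [e]
    refine (abs_sub _ _).trans ?_
    rw [abs_mul, abs_of_pos hh0]
    rw [Real.norm_eq_abs] at h2
    have := mul_le_mul_of_nonneg_left h3 hh0.le
    calc _ ≤ η * (h * M) + h * (L * (η * (T * M * Real.exp (T * M)))) := add_le_add h2 this
      _ = _ := by ring
  rw [hderiv, htel, Finset.mul_sum, ← neg_add', abs_neg, ← sub_eq_add_neg, abs_sub_comm,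
    ← Finset.sum_sub_distrib]
  refine (Finset.abs_sum_le_sum_abs _ _).trans ((Finset.sum_le_sum hterm).trans (le_of_eq ?_))
  rw [Finset.sum_const, Finset.card_range, nsmul_eq_mul]
  calc (N : ℝ) * (h * (η * (L * (T * M * Real.exp (T * M)) + M)))
      = η * (N * h * (L * (T * M * Real.exp (T * M)) + M)) := by ring
    _ = η * C := by rw [hNh]
    _ = ε := by rw [hη]; field_simp

end Euler

section Sign

variable {E : Type*} [NormedAddCommGroup E] [NormedSpace ℝ E] [FiniteDimensional ℝ E]

/-- A smooth cutoff between a compact set and an open neighbourhood. -/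
lemma exists_contDiff_cutoff {K U : Set E} (hK : IsCompact K) (hU : IsOpen U) (hKU : K ⊆ U) :
    ∃ f : E → ℝ, ContDiff ℝ 1 f ∧ HasCompactSupport f ∧ tsupport f ⊆ U ∧
      (∀ x, 0 ≤ f x ∧ f x ≤ 1) ∧ ∀ x ∈ K, f x = 1 := by
  obtain ⟨W, hW, hKW, hWU, hWc⟩ := exists_open_between_and_isCompact_closure hK hU hKU
  obtain ⟨f, hf, hf01, hfs, hf1⟩ := exists_contMDiff_support_eq_eq_one_iff
    (n := 1) (modelWithCornersSelf ℝ E) hW hK.isClosed hKW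
  refine ⟨f, hf.contDiff, ?_, ?_, fun x => ?_, fun x hx => (hf1 x).1 hx⟩
  · rw [HasCompactSupport, tsupport, hfs]; exact hWc
  · rw [tsupport, hfs]; exact hWU
  · exact hf01 (mem_range_self x)

variable [MeasurableSpace E] [BorelSpace E]

/-- The `L¹` norm on an open set is attained, up to `ε`, by integrating against a smooth compactly
supported function bounded by one. -/
lemma exists_contDiff_integral_abs_le {μ : Measure E} [SFinite μ] {U : Set E} (hU : IsOpen U)
    {ρ : E → ℝ} (hρm : Measurable ρ) (hρ : Integrable ρ (μ.restrict U)) {ε : ℝ} (hε : 0 < ε) :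
    ∃ g : E → ℝ, ContDiff ℝ 1 g ∧ HasCompactSupport g ∧ tsupport g ⊆ U ∧ (∀ x, |g x| ≤ 1) ∧
      ∫ x in U, |ρ x| ∂μ ≤ ∫ x in U, ρ x * g x ∂μ + ε := by
  set ν : Measure E := (μ.restrict U).withDensity fun x => ENNReal.ofReal |ρ x| with hν
  have hfin : IsFiniteMeasure ν := isFiniteMeasure_withDensity_ofReal hρ.abs.2
  have hνint : ∀ A, MeasurableSet A → ν A = ENNReal.ofReal (∫ x in A, |ρ x| ∂(μ.restrict U)) := by
    intro A hA
    rw [hν, withDensity_apply _ hA, ofReal_integral_eq_lintegral_ofReal hρ.abs.integrableOn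
      (Filter.Eventually.of_forall fun x => abs_nonneg _)]
  have hε' : ENNReal.ofReal (ε / 4) ≠ 0 := by simpa using hε
  have hA : MeasurableSet ({x | 0 < ρ x} ∩ U) :=
    (measurableSet_lt measurable_const hρm).inter hU.measurableSet
  have hB : MeasurableSet ({x | ρ x < 0} ∩ U) :=
    (measurableSet_lt hρm measurable_const).inter hU.measurableSet
  obtain ⟨K₁, hK₁A, hK₁, hν₁⟩ := hA.exists_isCompact_sdiff_lt (measure_ne_top ν _) hε'
  obtain ⟨K₂, hK₂B, hK₂, hν₂⟩ := hB.exists_isCompact_sdiff_lt (measure_ne_top ν _) hε'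
  obtain ⟨f₁, hf₁, hf₁c, hf₁s, hf₁01, hf₁1⟩ := exists_contDiff_cutoff hK₁
    (hU.inter hK₂.isClosed.isOpen_compl) (fun x hx => ⟨(hK₁A hx).2, fun h =>
      lt_asymm (show 0 < ρ x from (hK₁A hx).1) (hK₂B h).1⟩)
  obtain ⟨f₂, hf₂, hf₂c, hf₂s, hf₂01, hf₂1⟩ := exists_contDiff_cutoff hK₂
    (hU.inter hK₁.isClosed.isOpen_compl) (fun x hx => ⟨(hK₂B hx).2, fun h =>
      lt_asymm (show 0 < ρ x from (hK₁A h).1) (hK₂B hx).1⟩)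
  have habs : ∀ x, |f₁ x - f₂ x| ≤ 1 := fun x => by
    rw [abs_le]; constructor <;> linarith [(hf₁01 x).1, (hf₁01 x).2, (hf₂01 x).1, (hf₂01 x).2]
  refine ⟨fun x => f₁ x - f₂ x, hf₁.sub hf₂, hf₁c.sub hf₂c,
    (tsupport_sub f₁ f₂).trans (union_subset (hf₁s.trans inter_subset_left)
      (hf₂s.trans inter_subset_left)), habs, ?_⟩
  have hint : Integrable (fun x => ρ x * (f₁ x - f₂ x)) (μ.restrict U) := by
    refine hρ.mul_bdd (c := 1) (hf₁.sub hf₂).continuous.aestronglyMeasurable ?_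
    exact Filter.Eventually.of_forall habs
  set D₁ := ({x | 0 < ρ x} ∩ U) \ K₁ with hD₁
  set D₂ := ({x | ρ x < 0} ∩ U) \ K₂ with hD₂
  have hD₁m : MeasurableSet D₁ := hA.diff hK₁.measurableSet
  have hD₂m : MeasurableSet D₂ := hB.diff hK₂.measurableSet
  have hi : ∀ D, MeasurableSet D → ν D < ENNReal.ofReal (ε / 4) →
      ∫ x in U, D.indicator (fun x => |ρ x|) x ∂μ ≤ ε / 4 := by
    intro D hD hDν
    rw [integral_indicator hD]
    rw [hνint D hD, ENNReal.ofReal_lt_ofReal_iff (by positivity)] at hDν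
    exact hDν.le
  have hpt : ∀ x ∈ U, |ρ x| - ρ x * (f₁ x - f₂ x)
      ≤ 2 * (D₁.indicator (fun x => |ρ x|) x + D₂.indicator (fun x => |ρ x|) x) := by
    intro x hx
    have hz₁ : 0 ≤ D₁.indicator (fun x => |ρ x|) x := indicator_nonneg (fun _ _ => abs_nonneg _) _
    have hz₂ : 0 ≤ D₂.indicator (fun x => |ρ x|) x := indicator_nonneg (fun _ _ => abs_nonneg _) _
    have hb : |ρ x| - ρ x * (f₁ x - f₂ x) ≤ 2 * |ρ x| := by
      have h1 : |ρ x * (f₁ x - f₂ x)| ≤ |ρ x| * 1 := by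
        rw [abs_mul]; exact mul_le_mul_of_nonneg_left (habs x) (abs_nonneg _)
      linarith [neg_abs_le (ρ x * (f₁ x - f₂ x))]
    by_cases h₁ : x ∈ K₁
    · have e2 : f₂ x = 0 := by
        by_contra hne
        exact (hf₂s (subset_tsupport f₂ hne)).2 h₁
      have : |ρ x| = ρ x := abs_of_pos (hK₁A h₁).1
      rw [hf₁1 x h₁, e2, this]
      linarith
    by_cases h₂ : x ∈ K₂
    · have e1 : f₁ x = 0 := by
        by_contra hne
        exact (hf₁s (subset_tsupport f₁ hne)).2 h₂
      have : |ρ x| = -ρ x := abs_of_neg (hK₂B h₂).1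
      rw [hf₂1 x h₂, e1, this]
      linarith
    rcases lt_trichotomy (ρ x) 0 with h | h | h
    · have : x ∈ D₂ := ⟨⟨h, hx⟩, h₂⟩
      rw [indicator_of_mem this]
      linarith
    · simp only [h, abs_zero, zero_mul, sub_zero]
      linarith
    · have : x ∈ D₁ := ⟨⟨h, hx⟩, h₁⟩
      rw [indicator_of_mem this]
      linarith
  have hI₁ : Integrable (D₁.indicator fun x => |ρ x|) (μ.restrict U) := hρ.abs.indicator hD₁m
  have hI₂ : Integrable (D₂.indicator fun x => |ρ x|) (μ.restrict U) := hρ.abs.indicator hD₂m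
  have hmono := setIntegral_mono_on (hρ.abs.sub hint) ((hI₁.add hI₂).const_mul 2)
    hU.measurableSet hpt
  simp only [Pi.sub_apply, Pi.add_apply] at hmono
  rw [integral_sub hρ.abs hint, integral_const_mul, integral_add hI₁ hI₂] at hmono
  linarith [hi D₁ hD₁m hν₁, hi D₂ hD₂m hν₂]

end Sign

section Periodize

variable {E : Type*} [NormedAddCommGroup E] [NormedSpace ℝ E]

/-- Periodization, in the direction `e`, of a function living in the strip `0 < ℓ < 1`. -/
lemma contDiff_periodization {g : E → ℝ} (hg : ContDiff ℝ 1 g) (ℓ : E →L[ℝ] ℝ) (e : E)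
    (hℓe : ℓ e = 1) {δ : ℝ} (hδ : 0 < δ) (hs : ∀ p, g p ≠ 0 → δ ≤ ℓ p ∧ ℓ p ≤ 1 - δ) :
    ContDiff ℝ 1 (fun p => g (p - (⌊ℓ p⌋ : ℝ) • e)) := by
  have hfr : ∀ p, ℓ (p - (⌊ℓ p⌋ : ℝ) • e) = Int.fract (ℓ p) := fun p => by
    rw [map_sub, map_smul, hℓe, smul_eq_mul, mul_one, Int.self_sub_floor]
  rw [contDiff_iff_contDiffAt]
  intro p₀
  set n := ⌊ℓ p₀⌋ with hn
  have hn0 : (n : ℝ) ≤ ℓ p₀ := Int.floor_le _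
  have hn1 : ℓ p₀ < n + 1 := Int.lt_floor_add_one _
  by_cases hlt : ℓ p₀ < n + δ
  · refine (contDiffAt_const (c := (0 : ℝ))).congr_of_eventuallyEq ?_
    filter_upwards [ℓ.continuous.continuousAt.eventually_lt_const hlt,
      ℓ.continuous.continuousAt.eventually_const_lt (show (n : ℝ) - δ < ℓ p₀ by linarith)]
      with p hp1 hp2
    by_contra hne
    obtain ⟨h1, h2⟩ := hs _ hne
    rw [hfr] at h1 h2
    rw [Int.fract] at h1 h2
    have a1 : ((⌊ℓ p⌋ : ℤ) : ℝ) < n := by linarith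
    have a2 : ((n - 1 : ℤ) : ℝ) < ⌊ℓ p⌋ := by push_cast; linarith
    have a3 : ⌊ℓ p⌋ < n := by exact_mod_cast a1
    have a4 : n - 1 < ⌊ℓ p⌋ := by exact_mod_cast a2
    omega
  · push Not at hlt
    have : ContDiff ℝ 1 (fun p => g (p - (n : ℝ) • e)) :=
      hg.comp (contDiff_id.sub contDiff_const)
    refine this.contDiffAt.congr_of_eventuallyEq ?_
    filter_upwards [ℓ.continuous.continuousAt.eventually_lt_const hn1,
      ℓ.continuous.continuousAt.eventually_const_lt (show (n : ℝ) < ℓ p₀ by linarith)]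
      with p hp1 hp2
    have : ⌊ℓ p⌋ = n := Int.floor_eq_iff.2 ⟨hp2.le, hp1⟩
    rw [this]

end Periodize

section Slab

variable {L₁ L₂ a b T : ℝ}

lemma slabQ_eq_Icc (L₁ L₂ a b : ℝ) :
    slabQ L₁ L₂ a b = Icc ![0, 0, a] ![2 * Real.pi * L₁, 2 * Real.pi * L₂, b] := by
  ext x
  simp only [slabQ, mem_ofPred_eq, mem_Icc, Pi.le_def, Fin.forall_fin_succ]
  simp
  tauto

/-- The interior of the space-time cell `Q × (0,T)`. -/
def openCell (L₁ L₂ a b T : ℝ) : Set ((Fin 3 → ℝ) × ℝ) :=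
  (univ.pi fun i => Ioo (![0, 0, a] i) (![2 * Real.pi * L₁, 2 * Real.pi * L₂, b] i)) ×ˢ Ioo 0 T

lemma isOpen_openCell : IsOpen (openCell L₁ L₂ a b T) :=
  (isOpen_set_pi finite_univ fun _ _ => isOpen_Ioo).prod isOpen_Ioo

lemma restrict_openCell :
    (volume.restrict (openCell L₁ L₂ a b T) : Measure ((Fin 3 → ℝ) × ℝ))
      = volume.restrict (slabQ L₁ L₂ a b ×ˢ Ioo 0 T) := by
  rw [openCell, slabQ_eq_Icc]
  exact Measure.restrict_congr_set
    (Measure.set_prod_ae_eq Measure.univ_pi_Ioo_ae_eq_Icc Filter.EventuallyEq.rfl)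

lemma restrict_slabQ_prod :
    (volume.restrict (slabQ L₁ L₂ a b ×ˢ Ioo 0 T) : Measure ((Fin 3 → ℝ) × ℝ))
      = (volume.restrict (slabQ L₁ L₂ a b)).prod (volume.restrict (Ioo 0 T)) :=
  (Measure.prod_restrict _ _).symm

lemma isFiniteMeasure_restrict_slabQ_prod :
    IsFiniteMeasure (volume.restrict (slabQ L₁ L₂ a b ×ˢ Ioo 0 T) :
      Measure ((Fin 3 → ℝ) × ℝ)) := by
  have : IsFiniteMeasure (volume.restrict (slabQ L₁ L₂ a b)) := by
    rw [slabQ_eq_Icc]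
    exact ⟨by rw [Measure.restrict_apply_univ]; exact isCompact_Icc.measure_lt_top⟩
  rw [restrict_slabQ_prod]
  infer_instance

lemma measurableSet_slabQ_prod :
    MeasurableSet (slabQ L₁ L₂ a b ×ˢ Ioo (0 : ℝ) T) := by
  rw [slabQ_eq_Icc]
  exact measurableSet_Icc.prod measurableSet_Ioo

lemma integrable_of_lintegral_sq {q : (Fin 3 → ℝ) → ℝ → ℝ}
    (hq_meas : Measurable fun p : (Fin 3 → ℝ) × ℝ => q p.1 p.2)
    (hq_L2 : (∫⁻ t in Ioo (0:ℝ) T,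
        ∫⁻ x in slabQ L₁ L₂ a b, ENNReal.ofReal ((q x t) ^ 2)) < ⊤) :
    Integrable (fun p : (Fin 3 → ℝ) × ℝ => q p.1 p.2)
      (volume.restrict (slabQ L₁ L₂ a b ×ˢ Ioo 0 T)) := by
  have := isFiniteMeasure_restrict_slabQ_prod (L₁ := L₁) (L₂ := L₂) (a := a) (b := b) (T := T)
  have hsq : Integrable (fun p : (Fin 3 → ℝ) × ℝ => q p.1 p.2 ^ 2)
      (volume.restrict (slabQ L₁ L₂ a b ×ˢ Ioo 0 T)) := by
    refine ⟨(hq_meas.pow_const 2).aestronglyMeasurable, ?_⟩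
    rw [hasFiniteIntegral_iff_ofReal (Filter.Eventually.of_forall fun p => sq_nonneg _),
      restrict_slabQ_prod, lintegral_prod_symm]
    · exact hq_L2
    · exact (hq_meas.pow_const 2).ennreal_ofReal.aemeasurable
  refine ((integrable_const (1 : ℝ)).add hsq).mono' hq_meas.aestronglyMeasurable
    (Filter.Eventually.of_forall fun p => ?_)
  simp only [Pi.add_apply, Real.norm_eq_abs]
  rw [← sq_abs]
  nlinarith [sq_nonneg (|q p.1 p.2| - 1), abs_nonneg (q p.1 p.2)]

lemma integrable_mul_continuous {f k : (Fin 3 → ℝ) × ℝ → ℝ}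
    (hf : Integrable f (volume.restrict (slabQ L₁ L₂ a b ×ˢ Ioo 0 T))) (hk : Continuous k) :
    Integrable (fun p => f p * k p) (volume.restrict (slabQ L₁ L₂ a b ×ˢ Ioo 0 T)) := by
  have hc : IsCompact (slabQ L₁ L₂ a b ×ˢ Icc (0 : ℝ) T) := by
    rw [slabQ_eq_Icc]; exact isCompact_Icc.prod isCompact_Icc
  obtain ⟨C, hC⟩ := hc.exists_bound_of_continuousOn hk.continuousOn
  refine hf.mul_bdd (c := C) hk.aestronglyMeasurable ?_
  exact (ae_restrict_iff' measurableSet_slabQ_prod).2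
    (Filter.Eventually.of_forall fun p hp => hC p ⟨hp.1, Ioo_subset_Icc_self hp.2⟩)

lemma integral_slab_eq (hT : 0 ≤ T) {f : (Fin 3 → ℝ) × ℝ → ℝ}
    (hf : Integrable f (volume.restrict (slabQ L₁ L₂ a b ×ˢ Ioo 0 T))) :
    ∫ t in (0:ℝ)..T, ∫ x in slabQ L₁ L₂ a b, f (x, t)
      = ∫ p in slabQ L₁ L₂ a b ×ˢ Ioo 0 T, f p := by
  rw [intervalIntegral.integral_of_le hT, integral_Ioc_eq_integral_Ioo]
  rw [restrict_slabQ_prod] at hf ⊢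
  rw [integral_prod_symm _ hf]

variable {v : (Fin 3 → ℝ) → ℝ → (Fin 3 → ℝ)}

/-- The space-time vector field `(v, 1)`. -/
def spaceTimeField (v : (Fin 3 → ℝ) → ℝ → (Fin 3 → ℝ)) (p : (Fin 3 → ℝ) × ℝ) :
    (Fin 3 → ℝ) × ℝ := (v p.1 p.2, 1)

/-- The divergence of `v` in the space variable. -/
noncomputable def spaceDiv (v : (Fin 3 → ℝ) → ℝ → (Fin 3 → ℝ)) (p : (Fin 3 → ℝ) × ℝ) : ℝ :=
  ∑ i, fderiv ℝ (fun p : (Fin 3 → ℝ) × ℝ => v p.1 p.2) p (Pi.single i 1, 0) i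

lemma transport_adjoint_eq (hv : ContDiff ℝ 1 fun p : (Fin 3 → ℝ) × ℝ => v p.1 p.2)
    {φ : (Fin 3 → ℝ) × ℝ → ℝ} (hφ : ContDiff ℝ 1 φ) (x : Fin 3 → ℝ) (t : ℝ) :
    deriv (fun s => φ (x, s)) t
        + ∑ i, fderiv ℝ (fun y => v y t i * φ (y, t)) x (Pi.single i 1)
      = fderiv ℝ φ (x, t) (spaceTimeField v (x, t)) + spaceDiv v (x, t) * φ (x, t) := by
  have hφd := (hφ.differentiable one_ne_zero (x, t)).hasFDerivAt
  have hvd := (hv.differentiable one_ne_zero (x, t)).hasFDerivAt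
  have hinl : HasFDerivAt (fun y : Fin 3 → ℝ => (y, t))
      (ContinuousLinearMap.inl ℝ (Fin 3 → ℝ) ℝ) x := hasFDerivAt_prodMk_left x t
  have hφx : HasFDerivAt (fun y => φ (y, t))
      ((fderiv ℝ φ (x, t)).comp (ContinuousLinearMap.inl ℝ _ _)) x :=
    HasFDerivAt.comp (f := fun y : Fin 3 → ℝ => (y, t)) x hφd hinl
  have hvx : HasFDerivAt (fun y => v y t)
      ((fderiv ℝ (fun p : (Fin 3 → ℝ) × ℝ => v p.1 p.2) (x, t)).comp
        (ContinuousLinearMap.inl ℝ _ _)) x :=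
    HasFDerivAt.comp (f := fun y : Fin 3 → ℝ => (y, t)) x hvd hinl
  have ht : deriv (fun s => φ (x, s)) t = fderiv ℝ φ (x, t) (0, 1) := by
    have h1 : HasFDerivAt (fun s => φ (x, s))
        ((fderiv ℝ φ (x, t)).comp (ContinuousLinearMap.inr ℝ _ _)) t :=
      HasFDerivAt.comp (f := fun s : ℝ => (x, s)) t hφd (hasFDerivAt_prodMk_right x t)
    rw [h1.hasDerivAt.deriv]
    simp
  have hi : ∀ i, fderiv ℝ (fun y => v y t i * φ (y, t)) x (Pi.single i 1)
      = v x t i * fderiv ℝ φ (x, t) (Pi.single i 1, 0)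
        + fderiv ℝ (fun p : (Fin 3 → ℝ) × ℝ => v p.1 p.2) (x, t) (Pi.single i 1, 0) i
          * φ (x, t) := by
    intro i
    rw [((hasFDerivAt_pi'.1 hvx i).fun_mul hφx).fderiv]
    simp
    ring
  have hV : spaceTimeField v (x, t)
      = (0, 1) + ∑ i, v x t i • ((Pi.single i 1, 0) : (Fin 3 → ℝ) × ℝ) := by
    ext j
    · simp [spaceTimeField, Prod.fst_sum, Pi.single_apply]
    · simp [spaceTimeField, Prod.snd_sum]
  rw [ht, hV, map_add, map_sum, Finset.sum_congr rfl fun i _ => hi i, Finset.sum_add_distrib,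
    spaceDiv, Finset.sum_mul]
  simp only [map_smul, smul_eq_mul]
  ring

lemma contDiff_spaceTimeField (hv : ContDiff ℝ 1 fun p : (Fin 3 → ℝ) × ℝ => v p.1 p.2) :
    ContDiff ℝ 1 (spaceTimeField v) := hv.prodMk contDiff_const

lemma norm_fderiv_spaceTimeField_le (hv : ContDiff ℝ 1 fun p : (Fin 3 → ℝ) × ℝ => v p.1 p.2)
    {M : ℝ} (hv_der_bd : ∀ p : (Fin 3 → ℝ) × ℝ,
      ‖fderiv ℝ (fun p : (Fin 3 → ℝ) × ℝ => v p.1 p.2) p‖ ≤ M) (p : (Fin 3 → ℝ) × ℝ) :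
    ‖fderiv ℝ (spaceTimeField v) p‖ ≤ M := by
  have h : HasFDerivAt (spaceTimeField v) _ p :=
    (hv.differentiable one_ne_zero p).hasFDerivAt.prodMk (hasFDerivAt_const (1 : ℝ) p)
  rw [h.fderiv, ContinuousLinearMap.opNorm_prod, Prod.norm_mk, norm_zero]
  exact max_le (hv_der_bd p) ((norm_nonneg _).trans (hv_der_bd p))

lemma continuous_spaceDiv (hv : ContDiff ℝ 1 fun p : (Fin 3 → ℝ) × ℝ => v p.1 p.2) :
    Continuous (spaceDiv v) := by
  have := hv.continuous_fderiv one_ne_zero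
  unfold spaceDiv
  fun_prop

lemma abs_spaceDiv_le {M : ℝ} (hv_der_bd : ∀ p : (Fin 3 → ℝ) × ℝ,
      ‖fderiv ℝ (fun p : (Fin 3 → ℝ) × ℝ => v p.1 p.2) p‖ ≤ M) (p : (Fin 3 → ℝ) × ℝ) :
    |spaceDiv v p| ≤ 3 * M := by
  refine (Finset.abs_sum_le_sum_abs _ _).trans ?_
  have : ∀ i ∈ (Finset.univ : Finset (Fin 3)),
      |fderiv ℝ (fun p : (Fin 3 → ℝ) × ℝ => v p.1 p.2) p (Pi.single i 1, 0) i| ≤ M := by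
    intro i _
    refine (norm_le_pi_norm (fderiv ℝ (fun p : (Fin 3 → ℝ) × ℝ => v p.1 p.2) p
      (Pi.single i 1, 0)) i).trans ?_
    refine (ContinuousLinearMap.le_of_opNorm_le _ (hv_der_bd p) _).trans (le_of_eq ?_)
    rw [Prod.norm_mk, Pi.norm_single]
    simp
  refine (Finset.sum_le_sum this).trans (le_of_eq ?_)
  simp

/-- The normal velocity vanishes linearly at a wall. -/
lemma abs_normal_velocity_le (hv : ContDiff ℝ 1 fun p : (Fin 3 → ℝ) × ℝ => v p.1 p.2) {M : ℝ}
    (hv_der_bd : ∀ p : (Fin 3 → ℝ) × ℝ,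
      ‖fderiv ℝ (fun p : (Fin 3 → ℝ) × ℝ => v p.1 p.2) p‖ ≤ M)
    {w : ℝ} (hw : ∀ (x : Fin 3 → ℝ) (t : ℝ), x 2 = w → v x t 2 = 0) (x : Fin 3 → ℝ) (t : ℝ) :
    |v x t 2| ≤ M * |x 2 - w| := by
  have h := (convex_univ).norm_image_sub_le_of_norm_fderiv_le
    (f := fun p : (Fin 3 → ℝ) × ℝ => v p.1 p.2) (𝕜 := ℝ) (C := M)
    (x := (Function.update x 2 w, t)) (y := (x, t))
    (fun p _ => hv.differentiable one_ne_zero p) (fun p _ => hv_der_bd p) (mem_univ _) (mem_univ _)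
  have h2 : ‖(x, t) - (Function.update x 2 w, t)‖ = |x 2 - w| := by
    have : x - Function.update x 2 w = Pi.single 2 (x 2 - w) := by
      ext i
      by_cases hi : i = 2
      · subst hi; simp
      · simp [hi]
    rw [Prod.mk_sub_mk, this, Prod.norm_mk, Pi.norm_single]
    simp
  have h3 := (norm_le_pi_norm (v x t - v (Function.update x 2 w) t) 2).trans h
  rw [h2, Pi.sub_apply, hw (Function.update x 2 w) t (by simp), sub_zero] at h3
  exact h3

/-- A nonnegative margin shrinks at most geometrically under a multiplicatively bounded drift. -/
lemma lt_of_le_add_mul_abs {d : ℕ → ℝ} {κ δ : ℝ} (hκ : 0 ≤ κ) (hκ1 : κ ≤ 1) (hδ : 0 < δ)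
    (hd : ∀ k, d (k + 1) ≤ d k + κ * |d k|) (k : ℕ) (h0 : d 0 * (1 + κ) ^ k < δ) : d k < δ := by
  have key : ∀ k, max (d k) 0 ≤ max (d 0) 0 * (1 + κ) ^ k := by
    intro k
    induction k with
    | zero => simp
    | succ k ih =>
      have : max (d (k + 1)) 0 ≤ max (d k) 0 * (1 + κ) := by
        refine max_le ((hd k).trans ?_) (by positivity)
        rcases le_total 0 (d k) with h | h
        · rw [abs_of_nonneg h, max_eq_left h]; linarith
        · rw [abs_of_nonpos h, max_eq_right h]; nlinarith
      calc _ ≤ max (d k) 0 * (1 + κ) := this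
        _ ≤ max (d 0) 0 * (1 + κ) ^ k * (1 + κ) :=
          mul_le_mul_of_nonneg_right ih (by positivity)
        _ = _ := by ring
  refine (le_max_left _ _).trans_lt ((key k).trans_lt ?_)
  rcases le_total 0 (d 0) with h | h
  · rwa [max_eq_left h]
  · rw [max_eq_right h]; simpa using hδ

lemma eulerStep_spaceTimeField_iterate_snd (h : ℝ) (p : (Fin 3 → ℝ) × ℝ) (k : ℕ) :
    ((eulerStep (spaceTimeField v) h)^[k] p).2 = p.2 + k * h := by
  induction k with
  | zero => simp
  | succ k ih =>
    rw [Function.iterate_succ_apply', eulerStep, Prod.snd_add, ih]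
    simp [spaceTimeField]
    ring

lemma eulerPotential_add_period {E : Type*} [NormedAddCommGroup E] [NormedSpace ℝ E]
    {V : E → E} {F : E → ℝ} {e : E} (hV : ∀ p, V (p + e) = V p) (hF : ∀ p, F (p + e) = F p)
    (h : ℝ) (N : ℕ) (p : E) : eulerPotential V F h N (p + e) = eulerPotential V F h N p := by
  have : ∀ k, (eulerStep V h)^[k] (p + e) = (eulerStep V h)^[k] p + e := by
    intro k
    induction k with
    | zero => simp
    | succ k ih =>
      rw [Function.iterate_succ_apply', Function.iterate_succ_apply', ih]
      simp only [eulerStep, hV]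
      abel
  simp only [eulerPotential, this, hF]

lemma isTestFn_eulerPotential (hv : ContDiff ℝ 1 fun p : (Fin 3 → ℝ) × ℝ => v p.1 p.2)
    (hv_per : ∀ t : ℝ, HorPeriodic L₁ L₂ fun x => v x t) {M : ℝ} (hM : 0 ≤ M)
    (hv_der_bd : ∀ p : (Fin 3 → ℝ) × ℝ,
      ‖fderiv ℝ (fun p : (Fin 3 → ℝ) × ℝ => v p.1 p.2) p‖ ≤ M)
    (hv_bc : ∀ x : Fin 3 → ℝ, ∀ t : ℝ, x 2 = a ∨ x 2 = b → v x t 2 = 0)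
    {F : (Fin 3 → ℝ) × ℝ → ℝ} (hF : ContDiff ℝ 1 F)
    (hF_per : ∀ t : ℝ, HorPeriodic L₁ L₂ fun x => F (x, t)) {δ : ℝ} (hδ : 0 < δ)
    (hF_supp : ∀ p, F p ≠ 0 → δ ≤ p.1 2 - a ∧ δ ≤ b - p.1 2 ∧ p.2 ≤ T - δ)
    {h : ℝ} (hh : 0 ≤ h) (hhM : h * M ≤ 1) (N : ℕ) :
    IsTestFn L₁ L₂ a b T fun x t => eulerPotential (spaceTimeField v) F h N (x, t) := by
  set V := spaceTimeField v with hVdef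
  set r := (1 + h * M) ^ N with hr
  have hhM0 : 0 ≤ h * M := by positivity
  have hr0 : 0 < r := by positivity
  have hzero : ∀ p, (∀ k < N, F ((eulerStep V h)^[k] p) = 0) → eulerPotential V F h N p = 0 := by
    intro p hp
    rw [eulerPotential, Finset.sum_eq_zero fun k hk => hp k (Finset.mem_range.1 hk)]
    simp
  have hwall : ∀ (w s : ℝ), s = 1 ∨ s = -1 → (∀ (x : Fin 3 → ℝ) (t : ℝ), x 2 = w → v x t 2 = 0) →
      ∀ p : (Fin 3 → ℝ) × ℝ, s * (p.1 2 - w) < δ / r → ∀ k < N,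
        s * (((eulerStep V h)^[k] p).1 2 - w) < δ := by
    intro w s hs hw p hp k hk
    have hs1 : |s| = 1 := by rcases hs with rfl | rfl <;> simp
    refine lt_of_le_add_mul_abs (d := fun k => s * (((eulerStep V h)^[k] p).1 2 - w))
      hhM0 hhM hδ (fun k => ?_) k ?_
    · simp only [Function.iterate_succ_apply']
      set z := (eulerStep V h)^[k] p
      have h1 := abs_normal_velocity_le hv hv_der_bd hw z.1 z.2
      have h2 : s * v z.1 z.2 2 ≤ M * |z.1 2 - w| := by
        refine (le_abs_self _).trans ?_
        rwa [abs_mul, hs1, one_mul]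
      have h3 : (eulerStep V h z).1 2 = z.1 2 + h * v z.1 z.2 2 := by
        simp [eulerStep, hVdef, spaceTimeField]
      rw [h3, abs_mul, hs1, one_mul]
      nlinarith [mul_le_mul_of_nonneg_left h2 hh]
    · simp only [Function.iterate_zero, id_eq]
      rcases le_or_gt (s * (p.1 2 - w)) 0 with hle | hgt
      · exact (mul_nonpos_of_nonpos_of_nonneg hle (by positivity)).trans_lt hδ
      · rw [lt_div_iff₀ hr0] at hp
        refine lt_of_le_of_lt ?_ hp
        exact mul_le_mul_of_nonneg_left (pow_le_pow_right₀ (by linarith) hk.le) hgt.le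
  refine ⟨contDiff_eulerPotential (contDiff_spaceTimeField hv) hF h N, fun t x => ⟨?_, ?_⟩,
    ⟨Icc (a + δ / r) (b - δ / r), isCompact_Icc, ?_, ?_⟩, T - δ / 2, by linarith, ?_⟩
  · have := eulerPotential_add_period (V := V) (F := F)
      (e := ((2 * Real.pi * L₁) • (Pi.single 0 1 : Fin 3 → ℝ), (0 : ℝ)))
      (fun p => by
        simp only [hVdef, spaceTimeField, Prod.fst_add, Prod.snd_add, add_zero]
        exact Prod.ext (hv_per p.2 p.1).1 rfl)
      (fun p => by simpa [Prod.add_def] using (hF_per p.2 p.1).1) h N (x, t)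
    simpa [Prod.mk_add_mk] using this
  · have := eulerPotential_add_period (V := V) (F := F)
      (e := ((2 * Real.pi * L₂) • (Pi.single 1 1 : Fin 3 → ℝ), (0 : ℝ)))
      (fun p => by
        simp only [hVdef, spaceTimeField, Prod.fst_add, Prod.snd_add, add_zero]
        exact Prod.ext (hv_per p.2 p.1).2 rfl)
      (fun p => by simpa [Prod.add_def] using (hF_per p.2 p.1).2) h N (x, t)
    simpa [Prod.mk_add_mk] using this
  · have : 0 < δ / r := by positivity
    intro s hs
    exact ⟨by linarith [hs.1], by linarith [hs.2]⟩
  · intro x t hx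
    refine hzero _ fun k hk => ?_
    by_contra hne
    obtain ⟨h1, h2, -⟩ := hF_supp _ hne
    rw [mem_Icc, not_and_or, not_le, not_le] at hx
    rcases hx with hx | hx
    · have := hwall a 1 (Or.inl rfl) (fun x t hx => hv_bc x t (Or.inl hx)) (x, t)
        (by simp only; linarith) k hk
      linarith
    · have := hwall b (-1) (Or.inr rfl) (fun x t hx => hv_bc x t (Or.inr hx)) (x, t)
        (by simp only; linarith) k hk
      linarith
  · intro x t ht
    refine hzero _ fun k hk => ?_
    by_contra hne
    have h3 := (hF_supp _ hne).2.2
    rw [eulerStep_spaceTimeField_iterate_snd] at h3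
    have : 0 ≤ (k : ℝ) * h := by positivity
    simp only at h3
    linarith

end Slab

section Estimate

variable {L₁ L₂ a b T : ℝ} {v : (Fin 3 → ℝ) → ℝ → (Fin 3 → ℝ)}

lemma mul_geom_sum_exp_le {lam h : ℝ} (hlam : 0 < lam) (hh : 0 < h) (N : ℕ) :
    h * ∑ k ∈ Finset.range N, Real.exp (-(lam * (k * h))) ≤ h + 1 / lam := by
  set r := Real.exp (-(lam * h)) with hr
  have hx : 0 < lam * h := by positivity
  have hr0 : 0 < r := Real.exp_pos _
  have hr1 : r < 1 := Real.exp_lt_one_iff.2 (by linarith)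
  have hrx : r * (1 + lam * h) ≤ 1 := by
    have h1 := Real.add_one_le_exp (lam * h)
    have h2 : r * Real.exp (lam * h) = 1 := by rw [hr, ← Real.exp_add]; simp
    nlinarith
  have hsum : ∑ k ∈ Finset.range N, Real.exp (-(lam * (k * h))) = ∑ k ∈ Finset.range N, r ^ k := by
    refine Finset.sum_congr rfl fun k _ => ?_
    rw [hr, ← Real.exp_nat_mul]
    ring_nf
  have hmul := geom_sum_mul_neg r N
  have hrN : 0 < r ^ N := by positivity
  rw [hsum]
  set S := ∑ k ∈ Finset.range N, r ^ k
  have hS : 0 ≤ S := by positivity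
  have h3 : S * (lam * h) ≤ 1 + lam * h := by
    have : S * (1 - r) * (1 + lam * h) ≤ 1 + lam * h := by nlinarith
    nlinarith
  rw [show h + 1 / lam = (1 + lam * h) / lam by field_simp; ring, le_div_iff₀ hlam]
  linarith

lemma abs_eulerPotential_le {F : (Fin 3 → ℝ) × ℝ → ℝ} {lam h : ℝ} (hlam : 0 < lam) (hh : 0 < h)
    (hF : ∀ p, |F p| ≤ Real.exp (-(lam * p.2))) (N : ℕ) (p : (Fin 3 → ℝ) × ℝ) :
    |eulerPotential (spaceTimeField v) F h N p|
      ≤ Real.exp (-(lam * p.2)) * (h + 1 / lam) := by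
  rw [eulerPotential, abs_neg, abs_mul, abs_of_pos hh]
  calc h * |∑ k ∈ Finset.range N, F ((eulerStep (spaceTimeField v) h)^[k] p)|
      ≤ h * ∑ k ∈ Finset.range N, Real.exp (-(lam * p.2)) * Real.exp (-(lam * (k * h))) := by
        refine mul_le_mul_of_nonneg_left ((Finset.abs_sum_le_sum_abs _ _).trans
          (Finset.sum_le_sum fun k _ => (hF _).trans (le_of_eq ?_))) hh.le
        rw [eulerStep_spaceTimeField_iterate_snd, ← Real.exp_add]
        ring_nf
    _ = Real.exp (-(lam * p.2)) * (h * ∑ k ∈ Finset.range N, Real.exp (-(lam * (k * h)))) := by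
        rw [← Finset.mul_sum]; ring
    _ ≤ _ := mul_le_mul_of_nonneg_left (mul_geom_sum_exp_le hlam hh N) (Real.exp_pos _).le

lemma continuous_adjoint {c : (Fin 3 → ℝ) → ℝ → ℝ}
    (hv : ContDiff ℝ 1 fun p : (Fin 3 → ℝ) × ℝ => v p.1 p.2)
    (hc : ContDiff ℝ 1 fun p : (Fin 3 → ℝ) × ℝ => c p.1 p.2)
    {φ : (Fin 3 → ℝ) × ℝ → ℝ} (hφ : ContDiff ℝ 1 φ) :
    Continuous fun p : (Fin 3 → ℝ) × ℝ =>
      fderiv ℝ φ p (spaceTimeField v p) + (spaceDiv v p - c p.1 p.2) * φ p := by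
  have h1 := hφ.continuous_fderiv one_ne_zero
  have h2 := (contDiff_spaceTimeField hv).continuous
  have h3 : Continuous fun p => fderiv ℝ φ p (spaceTimeField v p) := h1.clm_apply h2
  exact h3.add (((continuous_spaceDiv hv).sub hc.continuous).mul hφ.continuous)

/-- The weak identity, in the form of a single integral over the space-time cell. -/
lemma integral_mul_adjoint_eq_zero (hT : 0 < T) {c : (Fin 3 → ℝ) → ℝ → ℝ}
    (hv : ContDiff ℝ 1 fun p : (Fin 3 → ℝ) × ℝ => v p.1 p.2)
    (hc : ContDiff ℝ 1 fun p : (Fin 3 → ℝ) × ℝ => c p.1 p.2) {q : (Fin 3 → ℝ) → ℝ → ℝ}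
    (hq : Integrable (fun p : (Fin 3 → ℝ) × ℝ => q p.1 p.2)
      (volume.restrict (slabQ L₁ L₂ a b ×ˢ Ioo 0 T)))
    {φ : (Fin 3 → ℝ) × ℝ → ℝ} (hφ : ContDiff ℝ 1 φ)
    (hweak : (∫ t in (0:ℝ)..T, ∫ x in slabQ L₁ L₂ a b,
        q x t * (deriv (fun s => φ (x, s)) t
          + (∑ i, fderiv ℝ (fun y => v y t i * φ (y, t)) x (Pi.single i 1))
          - c x t * φ (x, t))) = 0) :
    ∫ p in slabQ L₁ L₂ a b ×ˢ Ioo 0 T, q p.1 p.2 *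
      (fderiv ℝ φ p (spaceTimeField v p) + (spaceDiv v p - c p.1 p.2) * φ p) = 0 := by
  have hcont : Continuous fun p : (Fin 3 → ℝ) × ℝ =>
      fderiv ℝ φ p (spaceTimeField v p) + (spaceDiv v p - c p.1 p.2) * φ p :=
    continuous_adjoint hv hc hφ
  rw [← integral_slab_eq hT.le (integrable_mul_continuous hq hcont)]
  refine Eq.trans ?_ hweak
  refine intervalIntegral.integral_congr fun t _ => ?_
  refine integral_congr_ae (Filter.Eventually.of_forall fun x => ?_)
  simp only
  rw [transport_adjoint_eq hv hφ]
  ring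

/-- Duality estimate: a weak solution integrates weakly against data of exponential decay. -/
lemma abs_integral_mul_le (hT : 0 < T) {c : (Fin 3 → ℝ) → ℝ → ℝ}
    (hv : ContDiff ℝ 1 fun p : (Fin 3 → ℝ) × ℝ => v p.1 p.2)
    (hv_per : ∀ t : ℝ, HorPeriodic L₁ L₂ fun x => v x t) {M : ℝ} (hM : 1 ≤ M)
    (hv_bd : ∀ (x : Fin 3 → ℝ) (t : ℝ), ‖v x t‖ ≤ M)
    (hv_der_bd : ∀ p : (Fin 3 → ℝ) × ℝ,
      ‖fderiv ℝ (fun p : (Fin 3 → ℝ) × ℝ => v p.1 p.2) p‖ ≤ M)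
    (hv_bc : ∀ x : Fin 3 → ℝ, ∀ t : ℝ, x 2 = a ∨ x 2 = b → v x t 2 = 0)
    (hc : ContDiff ℝ 1 fun p : (Fin 3 → ℝ) × ℝ => c p.1 p.2)
    (hc_bd : ∀ (x : Fin 3 → ℝ) (t : ℝ), |c x t| ≤ M) {q : (Fin 3 → ℝ) → ℝ → ℝ}
    (hq : Integrable (fun p : (Fin 3 → ℝ) × ℝ => q p.1 p.2)
      (volume.restrict (slabQ L₁ L₂ a b ×ˢ Ioo 0 T)))
    (hweak : ∀ φ : (Fin 3 → ℝ) → ℝ → ℝ, IsTestFn L₁ L₂ a b T φ →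
      (∫ t in (0:ℝ)..T, ∫ x in slabQ L₁ L₂ a b,
        q x t * (deriv (φ x) t
          + (∑ i, fderiv ℝ (fun y => v y t i * φ y t) x (Pi.single i 1))
          - c x t * φ x t)) = 0)
    {F : (Fin 3 → ℝ) × ℝ → ℝ} (hF : ContDiff ℝ 1 F)
    (hF_per : ∀ t : ℝ, HorPeriodic L₁ L₂ fun x => F (x, t)) {δ : ℝ} (hδ : 0 < δ)
    (hF_supp : ∀ p, F p ≠ 0 → δ ≤ p.1 2 - a ∧ δ ≤ b - p.1 2 ∧ p.2 ≤ T - δ)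
    {lam : ℝ} (hlam : 0 < lam) (hF_bd : ∀ p, |F p| ≤ Real.exp (-(lam * p.2))) :
    |∫ p in slabQ L₁ L₂ a b ×ˢ Ioo 0 T, q p.1 p.2 * F p|
      ≤ 4 * M / lam * ∫ p in slabQ L₁ L₂ a b ×ˢ Ioo 0 T,
        |q p.1 p.2| * Real.exp (-(lam * p.2)) := by
  have hM0 : 0 < M := by linarith
  set μ : Measure ((Fin 3 → ℝ) × ℝ) := volume.restrict (slabQ L₁ L₂ a b ×ˢ Ioo 0 T) with hμ
  have hexp : Continuous fun p : (Fin 3 → ℝ) × ℝ => Real.exp (-(lam * p.2)) := by fun_prop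
  have hW : Integrable (fun p : (Fin 3 → ℝ) × ℝ => |q p.1 p.2| * Real.exp (-(lam * p.2))) μ :=
    integrable_mul_continuous hq.abs hexp
  set A := ∫ p, |q p.1 p.2| ∂μ with hA
  set W := ∫ p, |q p.1 p.2| * Real.exp (-(lam * p.2)) ∂μ with hWdef
  have hA0 : 0 ≤ A := integral_nonneg fun _ => abs_nonneg _
  have hW0 : 0 ≤ W := integral_nonneg fun _ => by positivity
  have hbdd : Bornology.IsBounded (slabQ L₁ L₂ a b ×ˢ Icc (0 : ℝ) T) := by
    rw [slabQ_eq_Icc]; exact (isCompact_Icc.prod isCompact_Icc).isBounded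
  obtain ⟨R, hR⟩ := hbdd.exists_norm_le
  have hVM : ∀ p, ‖spaceTimeField v p‖ ≤ M := fun p => by
    rw [spaceTimeField, Prod.norm_mk, norm_one]
    exact max_le (hv_bd _ _) hM
  suffices H : ∀ ε > 0, |∫ p, q p.1 p.2 * F p ∂μ| ≤ 4 * M / lam * W + ε * (A + 4 * M * W) by
    refine le_of_forall_pos_le_add fun ε hε => ?_
    have hD : 0 < A + 4 * M * W + 1 := by positivity
    refine (H (ε / (A + 4 * M * W + 1)) (by positivity)).trans ?_
    gcongr
    rw [div_mul_eq_mul_div, div_le_iff₀ hD]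
    nlinarith
  intro ε hε
  have hlim := tendsto_const_div_atTop_nhds_zero_nat T
  obtain ⟨N, hNF, hNε, hNM, hN⟩ := ((eventually_abs_fderiv_eulerPotential_sub_le
    (contDiff_spaceTimeField hv) hF hM0 hVM (norm_fderiv_spaceTimeField_le hv hv_der_bd)
    R hT hε).and ((hlim.eventually_le_const hε).and
      ((hlim.eventually_le_const (inv_pos.2 hM0)).and (Filter.eventually_gt_atTop 0)))).exists
  have hNr : (0 : ℝ) < N := by exact_mod_cast hN
  set h := T / (N : ℝ) with hh
  have hh0 : 0 < h := by positivity
  have hNh : N * h = T := by rw [hh]; field_simp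
  have hhM : h * M ≤ 1 := by
    calc h * M ≤ M⁻¹ * M := by gcongr
      _ = 1 := inv_mul_cancel₀ hM0.ne'
  set φ := eulerPotential (spaceTimeField v) F h N with hφdef
  have hφ : ContDiff ℝ 1 φ := contDiff_eulerPotential (contDiff_spaceTimeField hv) hF h N
  have hzero := integral_mul_adjoint_eq_zero hT hv hc hq hφ
    (hweak _ (isTestFn_eulerPotential hv hv_per hM0.le hv_der_bd hv_bc hF hF_per hδ hF_supp
      hh0.le hhM N))
  set D : (Fin 3 → ℝ) × ℝ → ℝ := fun p =>
    fderiv ℝ φ p (spaceTimeField v p) + (spaceDiv v p - c p.1 p.2) * φ p with hD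
  have hDc : Continuous D :=
    continuous_adjoint hv hc hφ
  have hpt : ∀ p ∈ slabQ L₁ L₂ a b ×ˢ Ioo (0 : ℝ) T,
      |D p - F p| ≤ ε + 4 * M * (ε + 1 / lam) * Real.exp (-(lam * p.2)) := by
    intro p hp
    have hF0 : F ((eulerStep (spaceTimeField v) h)^[N] p) = 0 := by
      by_contra hne
      have h3 := (hF_supp _ hne).2.2
      rw [eulerStep_spaceTimeField_iterate_snd, hNh] at h3
      linarith [hp.2.1]
    have h1 := hNF p (hR p ⟨hp.1, Ioo_subset_Icc_self hp.2⟩) hF0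
    have h2 := abs_eulerPotential_le (v := v) hlam hh0 hF_bd N p
    have h3 : |spaceDiv v p - c p.1 p.2| ≤ 4 * M := by
      refine (abs_sub _ _).trans ?_
      linarith [abs_spaceDiv_le hv_der_bd p, hc_bd p.1 p.2]
    have h4 : |(spaceDiv v p - c p.1 p.2) * φ p|
        ≤ 4 * M * (Real.exp (-(lam * p.2)) * (ε + 1 / lam)) := by
      rw [abs_mul]
      refine mul_le_mul h3 (h2.trans ?_) (abs_nonneg _) (by positivity)
      gcongr
    calc |D p - F p| = |(fderiv ℝ φ p (spaceTimeField v p) - F p)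
          + (spaceDiv v p - c p.1 p.2) * φ p| := by rw [hD]; ring_nf
      _ ≤ _ := abs_add_le _ _
      _ ≤ ε + 4 * M * (Real.exp (-(lam * p.2)) * (ε + 1 / lam)) := add_le_add h1 h4
      _ = _ := by ring
  have hqF := integrable_mul_continuous hq hF.continuous
  have hqD := integrable_mul_continuous hq hDc
  have heq : ∫ p, q p.1 p.2 * F p ∂μ = -∫ p, q p.1 p.2 * (D p - F p) ∂μ := by
    simp only [mul_sub]
    rw [integral_sub hqD hqF, hzero]
    ring
  rw [heq, abs_neg]
  have hbound : |∫ p, q p.1 p.2 * (D p - F p) ∂μ| ≤ ∫ p, (ε * |q p.1 p.2|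
      + 4 * M * (ε + 1 / lam) * (|q p.1 p.2| * Real.exp (-(lam * p.2)))) ∂μ := by
    rw [← Real.norm_eq_abs]
    refine norm_integral_le_of_norm_le ((hq.abs.const_mul ε).add (hW.const_mul _)) ?_
    refine (ae_restrict_iff' measurableSet_slabQ_prod).2
      (Filter.Eventually.of_forall fun p hp => ?_)
    rw [Real.norm_eq_abs, abs_mul]
    refine (mul_le_mul_of_nonneg_left (hpt p hp) (abs_nonneg _)).trans (le_of_eq ?_)
    ring
  refine hbound.trans (le_of_eq ?_)
  rw [integral_add (hq.abs.const_mul ε) (hW.const_mul _), integral_const_mul, integral_const_mul]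
  ring

/-- Horizontally periodic extension of a function supported in the open cell. -/
lemma exists_horPeriodic_extension (hL₁ : 0 < L₁) (hL₂ : 0 < L₂) {g : (Fin 3 → ℝ) × ℝ → ℝ}
    (hg : ContDiff ℝ 1 g) (hgc : HasCompactSupport g)
    (hgs : tsupport g ⊆ openCell L₁ L₂ a b T) (hg1 : ∀ p, |g p| ≤ 1) :
    ∃ G : (Fin 3 → ℝ) × ℝ → ℝ, ContDiff ℝ 1 G ∧ (∀ t : ℝ, HorPeriodic L₁ L₂ fun x => G (x, t)) ∧
      (∃ δ > 0, ∀ p, G p ≠ 0 → δ ≤ p.1 2 - a ∧ δ ≤ b - p.1 2 ∧ p.2 ≤ T - δ) ∧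
      (∀ p, |G p| ≤ 1) ∧ ∀ p ∈ openCell L₁ L₂ a b T, G p = g p := by
  have hP₁ : 0 < 2 * Real.pi * L₁ := by positivity
  have hP₂ : 0 < 2 * Real.pi * L₂ := by positivity
  set P₁ := 2 * Real.pi * L₁ with hP₁def
  set P₂ := 2 * Real.pi * L₂ with hP₂def
  have hmem : ∀ p : (Fin 3 → ℝ) × ℝ, p ∈ openCell L₁ L₂ a b T ↔
      (0 < p.1 0 ∧ p.1 0 < P₁) ∧ (0 < p.1 1 ∧ p.1 1 < P₂) ∧ (a < p.1 2 ∧ p.1 2 < b) ∧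
        (0 < p.2 ∧ p.2 < T) := by
    intro p
    simp [openCell, Fin.forall_fin_succ, and_assoc, hP₁def, hP₂def]
  have hmargin : ∀ u : (Fin 3 → ℝ) × ℝ → ℝ, Continuous u →
      (∀ p ∈ openCell L₁ L₂ a b T, 0 < u p) → ∃ δ > 0, ∀ p, g p ≠ 0 → δ ≤ u p := by
    intro u hu hpos
    obtain ⟨δ, hδ, H⟩ := hgc.isCompact.exists_forall_le' (a := 0) hu.continuousOn
      fun p hp => hpos p (hgs hp)
    exact ⟨δ, hδ, fun p hp => H p (subset_tsupport g hp)⟩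
  obtain ⟨δ₁, hδ₁, H₁⟩ := hmargin (fun p => min (p.1 0 / P₁) (1 - p.1 0 / P₁)) (by fun_prop)
    fun p hp => lt_min (div_pos ((hmem p).1 hp).1.1 hP₁)
      (sub_pos.2 ((div_lt_one hP₁).2 ((hmem p).1 hp).1.2))
  obtain ⟨δ₂, hδ₂, H₂⟩ := hmargin (fun p => min (p.1 1 / P₂) (1 - p.1 1 / P₂)) (by fun_prop)
    fun p hp => lt_min (div_pos ((hmem p).1 hp).2.1.1 hP₂)
      (sub_pos.2 ((div_lt_one hP₂).2 ((hmem p).1 hp).2.1.2))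
  obtain ⟨δ, hδ, H₃⟩ := hmargin (fun p => min (p.1 2 - a) (min (b - p.1 2) (T - p.2)))
    (by fun_prop) fun p hp => by
      obtain ⟨-, -, h3, h4⟩ := (hmem p).1 hp
      exact lt_min (by linarith) (lt_min (by linarith) (by linarith))
  let pr : Fin 3 → ((Fin 3 → ℝ) × ℝ →L[ℝ] ℝ) := fun i =>
    (ContinuousLinearMap.proj i).comp (ContinuousLinearMap.fst ℝ (Fin 3 → ℝ) ℝ)
  let ℓ₁ : (Fin 3 → ℝ) × ℝ →L[ℝ] ℝ := P₁⁻¹ • pr 0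
  let ℓ₂ : (Fin 3 → ℝ) × ℝ →L[ℝ] ℝ := P₂⁻¹ • pr 1
  let e₁ : (Fin 3 → ℝ) × ℝ := (P₁ • (Pi.single 0 1 : Fin 3 → ℝ), 0)
  let e₂ : (Fin 3 → ℝ) × ℝ := (P₂ • (Pi.single 1 1 : Fin 3 → ℝ), 0)
  have hℓ₁ : ∀ p, ℓ₁ p = p.1 0 / P₁ := fun p => by simp [ℓ₁, pr, div_eq_inv_mul]
  have hℓ₂ : ∀ p, ℓ₂ p = p.1 1 / P₂ := fun p => by simp [ℓ₂, pr, div_eq_inv_mul]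
  have h11 : ℓ₁ e₁ = 1 := by simp [hℓ₁, e₁, hP₁.ne']
  have h22 : ℓ₂ e₂ = 1 := by simp [hℓ₂, e₂, hP₂.ne']
  have h12 : ℓ₁ e₂ = 0 := by simp [hℓ₁, e₂]
  have h21 : ℓ₂ e₁ = 0 := by simp [hℓ₂, e₁]
  let g₁ : (Fin 3 → ℝ) × ℝ → ℝ := fun p => g (p - (⌊ℓ₁ p⌋ : ℝ) • e₁)
  have hg₁ : ContDiff ℝ 1 g₁ := contDiff_periodization hg ℓ₁ e₁ h11 hδ₁ fun p hp => by
    have := le_min_iff.1 (H₁ p hp)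
    rw [hℓ₁]
    exact ⟨this.1, by linarith [this.2]⟩
  let G : (Fin 3 → ℝ) × ℝ → ℝ := fun p => g₁ (p - (⌊ℓ₂ p⌋ : ℝ) • e₂)
  have hG : ContDiff ℝ 1 G := contDiff_periodization hg₁ ℓ₂ e₂ h22 hδ₂ fun p hp => by
    have := le_min_iff.1 (H₂ _ hp)
    simp only [← hℓ₂, map_sub, map_smul, h21, smul_zero, sub_zero] at this
    exact ⟨this.1, by linarith [this.2]⟩
  have hGg : ∀ p, G p = g (p - (⌊ℓ₁ p⌋ : ℝ) • e₁ - (⌊ℓ₂ p⌋ : ℝ) • e₂) := by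
    intro p
    simp only [G, g₁, map_sub, map_smul, h12, smul_zero, sub_zero]
    congr 1
    abel
  refine ⟨G, hG, fun t x => ⟨?_, ?_⟩, ⟨δ, hδ, fun p hp => ?_⟩, fun p => ?_, fun p hp => ?_⟩
  · have : ((x + P₁ • (Pi.single 0 1 : Fin 3 → ℝ), t) : (Fin 3 → ℝ) × ℝ) = (x, t) + e₁ := by
      simp [e₁]
    simp only
    rw [this, hGg, hGg, map_add, map_add, h11, h21, add_zero, Int.floor_add_one]
    congr 1
    push_cast
    module
  · have : ((x + P₂ • (Pi.single 1 1 : Fin 3 → ℝ), t) : (Fin 3 → ℝ) × ℝ) = (x, t) + e₂ := by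
      simp [e₂]
    simp only
    rw [this, hGg, hGg, map_add, map_add, h22, h12, add_zero, Int.floor_add_one]
    congr 1
    push_cast
    module
  · rw [hGg] at hp
    have h := H₃ _ hp
    simp [e₁, e₂] at h
    exact ⟨h.1, h.2.1, by linarith [h.2.2]⟩
  · rw [hGg]; exact hg1 _
  · obtain ⟨⟨h1, h2⟩, ⟨h3, h4⟩, -⟩ := (hmem p).1 hp
    have f₁ : ⌊ℓ₁ p⌋ = 0 := by
      rw [hℓ₁, Int.floor_eq_zero_iff]
      exact ⟨by positivity, (div_lt_one hP₁).2 h2⟩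
    have f₂ : ⌊ℓ₂ p⌋ = 0 := by
      rw [hℓ₂, Int.floor_eq_zero_iff]
      exact ⟨by positivity, (div_lt_one hP₂).2 h4⟩
    rw [hGg, f₁, f₂]
    simp

end Estimate

/-- Proposition 8.3: uniqueness of weak `L²` solutions of the transport problem
on the horizontally periodic slab.  If `q ∈ L²(Q × (0,T))` is measurable,
horizontally periodic, and satisfies the homogeneous weak identity
`∫₀^T ∫_Q q·(∂_tφ + div(vφ) − cφ) = 0` against every test function `φ`, then
`q = 0` almost everywhere on `Q × (0,T)`. -/
theorem stmt_13
    (L₁ L₂ a b T : ℝ) (hL₁ : 0 < L₁) (hL₂ : 0 < L₂) (hab : a < b) (hT : 0 < T)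
    (v : (Fin 3 → ℝ) → ℝ → (Fin 3 → ℝ)) (c : (Fin 3 → ℝ) → ℝ → ℝ)
    (hv : ContDiff ℝ 1 fun p : (Fin 3 → ℝ) × ℝ => v p.1 p.2)
    (hv_per : ∀ t : ℝ, HorPeriodic L₁ L₂ fun x => v x t)
    (M : ℝ)
    (hv_bd : ∀ (x : Fin 3 → ℝ) (t : ℝ), ‖v x t‖ ≤ M)
    (hv_der_bd : ∀ p : (Fin 3 → ℝ) × ℝ,
      ‖fderiv ℝ (fun p : (Fin 3 → ℝ) × ℝ => v p.1 p.2) p‖ ≤ M)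
    (hv_bc : ∀ x : Fin 3 → ℝ, ∀ t : ℝ, x 2 = a ∨ x 2 = b → v x t 2 = 0)
    (hc : ContDiff ℝ 1 fun p : (Fin 3 → ℝ) × ℝ => c p.1 p.2)
    (hc_per : ∀ t : ℝ, HorPeriodic L₁ L₂ fun x => c x t)
    (hc_bd : ∀ (x : Fin 3 → ℝ) (t : ℝ), |c x t| ≤ M)
    (q : (Fin 3 → ℝ) → ℝ → ℝ)
    (hq_meas : Measurable fun p : (Fin 3 → ℝ) × ℝ => q p.1 p.2)
    (hq_per : ∀ t : ℝ, HorPeriodic L₁ L₂ fun x => q x t)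
    (hq_L2 : (∫⁻ t in Ioo (0:ℝ) T,
        ∫⁻ x in slabQ L₁ L₂ a b, ENNReal.ofReal ((q x t) ^ 2)) < ⊤)
    (hweak : ∀ φ : (Fin 3 → ℝ) → ℝ → ℝ, IsTestFn L₁ L₂ a b T φ →
      (∫ t in (0:ℝ)..T, ∫ x in slabQ L₁ L₂ a b,
        q x t * (deriv (φ x) t
          + (∑ i, fderiv ℝ (fun y => v y t i * φ y t) x (Pi.single i 1))
          - c x t * φ x t)) = 0) :
    ∀ᵐ p : (Fin 3 → ℝ) × ℝ
      ∂(volume.restrict (slabQ L₁ L₂ a b ×ˢ Ioo (0:ℝ) T)),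
      q p.1 p.2 = 0 := by
  set M' := max M 1 with hM'
  have hMM' : M ≤ M' := le_max_left _ _
  have hM1 : 1 ≤ M' := le_max_right _ _
  have hq := integrable_of_lintegral_sq hq_meas hq_L2
  set μ : Measure ((Fin 3 → ℝ) × ℝ) := volume.restrict (slabQ L₁ L₂ a b ×ˢ Ioo 0 T) with hμ
  set lam := 8 * M' with hlam
  have hlam0 : 0 < lam := by positivity
  set ρ : (Fin 3 → ℝ) × ℝ → ℝ := fun p => q p.1 p.2 * Real.exp (-(lam * p.2)) with hρdef
  have hexp : ContDiff ℝ 1 fun p : (Fin 3 → ℝ) × ℝ => Real.exp (-(lam * p.2)) := by fun_prop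
  have hρ : Integrable ρ μ := integrable_mul_continuous hq hexp.continuous
  have hρabs : ∀ p, |ρ p| = |q p.1 p.2| * Real.exp (-(lam * p.2)) := fun p => by
    rw [hρdef, abs_mul, Real.abs_exp]
  have hsmall : ∀ ε > 0, ∫ p, |ρ p| ∂μ ≤ 2 * ε := by
    intro ε hε
    obtain ⟨g, hg, hgc, hgs, hg1, hgε⟩ := exists_contDiff_integral_abs_le (μ := volume)
      (isOpen_openCell (L₁ := L₁) (L₂ := L₂) (a := a) (b := b) (T := T)) (ρ := ρ)
      (hq_meas.mul hexp.continuous.measurable) (by rw [restrict_openCell]; exact hρ) hε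
    obtain ⟨G, hG, hG_per, ⟨δ, hδ, hG_supp⟩, hG1, hGg⟩ :=
      exists_horPeriodic_extension hL₁ hL₂ hg hgc hgs hg1
    have key := abs_integral_mul_le hT hv hv_per hM1 (fun x t => (hv_bd x t).trans hMM')
      (fun p => (hv_der_bd p).trans hMM') hv_bc hc (fun x t => (hc_bd x t).trans hMM') hq hweak
      (F := fun p => Real.exp (-(lam * p.2)) * G p) (hexp.mul hG)
      (fun t x => ⟨congrArg _ (hG_per t x).1, congrArg _ (hG_per t x).2⟩) hδ
      (fun p hp => hG_supp p (right_ne_zero_of_mul hp)) hlam0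
      (fun p => by
        rw [abs_mul, Real.abs_exp]
        exact mul_le_of_le_one_right (Real.exp_pos _).le (hG1 p))
    have e1 : ∫ p in openCell L₁ L₂ a b T, ρ p * g p
        = ∫ p, q p.1 p.2 * (Real.exp (-(lam * p.2)) * G p) ∂μ := by
      rw [hμ, ← restrict_openCell]
      refine setIntegral_congr_fun isOpen_openCell.measurableSet fun p hp => ?_
      simp only [hρdef, hGg p hp]
      ring
    have e2 : 4 * M' / lam = 1 / 2 := by
      rw [hlam]; field_simp; norm_num
    rw [e1, restrict_openCell] at hgε
    simp only [← hρabs] at key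
    rw [e2] at key
    linarith [le_abs_self (∫ p, q p.1 p.2 * (Real.exp (-(lam * p.2)) * G p) ∂μ)]
  have hzero : ∫ p, |ρ p| ∂μ = 0 := by
    refine le_antisymm (le_of_forall_pos_le_add fun ε hε => ?_)
      (integral_nonneg fun _ => abs_nonneg _)
    linarith [hsmall (ε / 2) (by positivity)]
  have hae := (integral_eq_zero_iff_of_nonneg (fun _ => abs_nonneg _) hρ.abs).1 hzero
  filter_upwards [hae] with p hp
  have hp' : ρ p = 0 := abs_eq_zero.1 hp
  exact (mul_eq_zero.1 hp').resolve_right (Real.exp_pos _).ne'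
end
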